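/- Fix integers d ≥ 2 and N ≥ 1, a traceless Hermitian matrix h ∈ M_d(ℂ), and a unit vector ψ_N ∈ (ℂ^d)^{⊗N}. For U ∈ SU(d^N) define F^{LU}(U) := sup over all N-tuples (V_1,…,V_N) of d×d unitary matrices of 4·(tr(ρ_V H_N²) − (tr(ρ_V H_N))²), where ρ_V := (V_1⊗⋯⊗V_N)·U|ψ_N⟩⟨ψ_N|U†·(V_1⊗⋯⊗V_N)†. Then the expectation of F^{LU} with respect to the Haar probability measure on SU(d^N) satisfies E_{U∼μ(d^N)} F^{LU}(U) ≤ 4N‖h‖²·(1 + (N−1)d²/√(d^N)). -/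

import Mathlib

open MeasureTheory Matrix Finset
open scoped ComplexOrder

noncomputable section

namespace Paper

instance matrixMeasurableSpace {m n : Type*} : MeasurableSpace (Matrix m n ℂ) :=
  (inferInstance : MeasurableSpace (m → n → ℂ))

/-- The operator norm (w.r.t. the Euclidean norm) of a square matrix. -/
def opNorm {n : Type*} [Fintype n] [DecidableEq n] (A : Matrix n n ℂ) : ℝ :=
  ‖Matrix.toEuclideanCLM (𝕜 := ℂ) A‖

/-- The Hamiltonian `H_N = Σ_j h^{(j)}` on `N` particles, acting as `h` on the `j`-th
tensor factor and as the identity on the others. -/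
def localHam (d N : ℕ) (h : Matrix (Fin d) (Fin d) ℂ) :
    Matrix (Fin N → Fin d) (Fin N → Fin d) ℂ :=
  ∑ j : Fin N, Matrix.of fun x y =>
    if ∀ i, i ≠ j → x i = y i then h (x j) (y j) else 0

/-- The tensor product `V_1 ⊗ ⋯ ⊗ V_N` of `N` one-particle matrices. -/
def tensorProd {d N : ℕ} (V : Fin N → Matrix (Fin d) (Fin d) ℂ) :
    Matrix (Fin N → Fin d) (Fin N → Fin d) ℂ :=
  Matrix.of fun x y => ∏ j, V j (x j) (y j)

/-- The LU-optimized quantum Fisher information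
`F^{LU}(U) = sup_{V_1,…,V_N unitary} 4·(tr(ρ_V H_N²) − (tr(ρ_V H_N))²)` where
`ρ_V = (V_1⊗⋯⊗V_N)·U|ψ⟩⟨ψ|U†·(V_1⊗⋯⊗V_N)†`. -/
def FLU (d N : ℕ) (h : Matrix (Fin d) (Fin d) ℂ) (ψ : (Fin N → Fin d) → ℂ)
    (U : Matrix.specialUnitaryGroup (Fin N → Fin d) ℂ) : ℝ :=
  ⨆ V : Fin N → Matrix.unitaryGroup (Fin d) ℂ,
    4 * ((Matrix.trace
            ((tensorProd fun j => (V j : Matrix (Fin d) (Fin d) ℂ)) *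
              (U.1 * Matrix.vecMulVec ψ (star ψ) * star U.1) *
              star (tensorProd fun j => (V j : Matrix (Fin d) (Fin d) ℂ)) *
              (localHam d N h * localHam d N h))).re -
        ((Matrix.trace
            ((tensorProd fun j => (V j : Matrix (Fin d) (Fin d) ℂ)) *
              (U.1 * Matrix.vecMulVec ψ (star ψ) * star U.1) *
              star (tensorProd fun j => (V j : Matrix (Fin d) (Fin d) ℂ)) *
              localHam d N h)).re) ^ 2)

section ProductOperators

variable {ι n : Type*}

lemma star_mulSingle [DecidableEq ι] [Fintype n] [DecidableEq n] (j : ι) (h : Matrix n n ℂ) :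
    star (Pi.mulSingle j h : ι → Matrix n n ℂ) = Pi.mulSingle j (star h) := by
  ext1 i
  by_cases hi : i = j
  · subst hi; simp
  · simp [Pi.mulSingle_eq_of_ne hi]

variable [Fintype ι]

/-- The tensor product `⨂ i, V i` of a finite family of square matrices. -/
def piKron (V : ι → Matrix n n ℂ) : Matrix (ι → n) (ι → n) ℂ :=
  Matrix.of fun x y => ∏ i, V i (x i) (y i)

lemma piKron_apply (V : ι → Matrix n n ℂ) (x y : ι → n) :
    piKron V x y = ∏ i, V i (x i) (y i) := rfl

lemma piKron_one [DecidableEq n] : piKron (1 : ι → Matrix n n ℂ) = 1 := by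
  ext x y
  simp only [piKron_apply, Pi.one_apply, Matrix.one_apply, Finset.prod_ite_zero]
  simp [funext_iff]

lemma star_piKron (V : ι → Matrix n n ℂ) : star (piKron V) = piKron (star V) := by
  ext x y
  simp [Matrix.star_apply, piKron_apply, Pi.star_apply]

lemma piKron_mulSingle_apply [DecidableEq ι] [DecidableEq n] (j : ι) (h : Matrix n n ℂ) (x y : ι → n) :
    piKron (Pi.mulSingle j h) x y = if ∀ i, i ≠ j → x i = y i then h (x j) (y j) else 0 := by
  rw [piKron_apply, ← Finset.mul_prod_erase _ _ (Finset.mem_univ j), Pi.mulSingle_eq_same]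
  have : ∀ i ∈ Finset.univ.erase j, (Pi.mulSingle j h : ι → Matrix n n ℂ) i (x i) (y i)
      = if x i = y i then 1 else 0 := by
    intro i hi
    rw [Pi.mulSingle_eq_of_ne (Finset.ne_of_mem_erase hi), Matrix.one_apply]
  rw [Finset.prod_congr rfl this, Finset.prod_ite_zero]
  simp

variable [Fintype n]

lemma piKron_mul [DecidableEq ι] (V W : ι → Matrix n n ℂ) : piKron V * piKron W = piKron (V * W) := by
  ext x y
  simp only [Matrix.mul_apply, piKron_apply, Pi.mul_apply, Finset.prod_univ_sum,
    Fintype.piFinset_univ, Finset.prod_mul_distrib]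

lemma trace_piKron [DecidableEq ι] (V : ι → Matrix n n ℂ) : (piKron V).trace = ∏ i, (V i).trace := by
  simp only [Matrix.trace, Matrix.diag, piKron_apply, Finset.prod_univ_sum,
    Fintype.piFinset_univ]

/-- The squared Frobenius norm of a matrix. -/
def frobSq (A : Matrix n n ℂ) : ℝ := ∑ a, ∑ b, ‖A a b‖ ^ 2

lemma ofReal_frobSq (A : Matrix n n ℂ) : (frobSq A : ℂ) = (A * star A).trace := by
  simp [frobSq, Matrix.trace, Matrix.mul_apply, Matrix.star_apply, Complex.mul_conj']

lemma frobSq_nonneg (A : Matrix n n ℂ) : 0 ≤ frobSq A := by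
  unfold frobSq; positivity

lemma frobSq_piKron [DecidableEq ι] (V : ι → Matrix n n ℂ) : frobSq (piKron V) = ∏ i, frobSq (V i) := by
  have : (frobSq (piKron V) : ℂ) = ((∏ i, frobSq (V i) : ℝ) : ℂ) := by
    rw [ofReal_frobSq, star_piKron, piKron_mul, trace_piKron]
    push_cast
    simp only [ofReal_frobSq, Pi.mul_apply, Pi.star_apply]
  exact_mod_cast this

lemma star_dotProduct_self (x : n → ℂ) : star x ⬝ᵥ x = ((∑ i, ‖x i‖ ^ 2 : ℝ) : ℂ) := by
  simp [dotProduct, Complex.conj_mul']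

variable [DecidableEq n]

lemma frobSq_conj (V : Matrix n n ℂ) (hV : V ∈ Matrix.unitaryGroup n ℂ) (h : Matrix n n ℂ) :
    frobSq (star V * h * V) = frobSq h := by
  have hV' := Matrix.mem_unitaryGroup_iff.1 hV
  have : (frobSq (star V * h * V) : ℂ) = frobSq h := by
    rw [ofReal_frobSq, ofReal_frobSq]
    calc _ = (star V * (h * (V * star V) * star h * V)).trace := by
          simp only [star_mul, star_star, Matrix.mul_assoc]
      _ = _ := by
          rw [hV', Matrix.mul_one, Matrix.trace_mul_comm, Matrix.mul_assoc, hV', Matrix.mul_one]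
  exact_mod_cast this

lemma sum_norm_sq_mulVec_le (h : Matrix n n ℂ) (x : n → ℂ) :
    ∑ i, ‖(h *ᵥ x) i‖ ^ 2 ≤ opNorm h ^ 2 * ∑ i, ‖x i‖ ^ 2 := by
  have := (Matrix.toEuclideanCLM (𝕜 := ℂ) h).le_opNorm (WithLp.toLp 2 x)
  rw [Matrix.toEuclideanCLM_toLp] at this
  have h2 := pow_le_pow_left₀ (norm_nonneg _) this 2
  rwa [mul_pow, EuclideanSpace.norm_sq_eq, EuclideanSpace.norm_sq_eq] at h2

lemma posSemidef_opNorm_sub (h : Matrix n n ℂ) :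
    (((opNorm h ^ 2 : ℝ) : ℂ) • (1 : Matrix n n ℂ) - star h * h).PosSemidef := by
  refine Matrix.PosSemidef.of_dotProduct_mulVec_nonneg ?_ fun x => ?_
  · rw [Matrix.IsHermitian, Matrix.star_eq_conjTranspose]
    simp [Matrix.conjTranspose_sub, Matrix.conjTranspose_smul, Matrix.conjTranspose_mul]
  · have h1 : star x ⬝ᵥ ((star h * h) *ᵥ x) = ((∑ i, ‖(h *ᵥ x) i‖ ^ 2 : ℝ) : ℂ) := by
      rw [← star_dotProduct_self, ← Matrix.mulVec_mulVec, Matrix.dotProduct_mulVec,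
        Matrix.star_mulVec, Matrix.star_eq_conjTranspose]
    rw [Matrix.sub_mulVec, dotProduct_sub, h1, Matrix.smul_mulVec, Matrix.one_mulVec,
      dotProduct_smul, star_dotProduct_self, smul_eq_mul, ← Complex.ofReal_mul,
      ← Complex.ofReal_sub, Complex.zero_le_real, sub_nonneg]
    exact sum_norm_sq_mulVec_le h x

lemma frobSq_le (h : Matrix n n ℂ) : frobSq h ≤ Fintype.card n * opNorm h ^ 2 := by
  have h1 := (posSemidef_opNorm_sub h).trace_nonneg
  rw [Matrix.trace_sub, Matrix.trace_smul, Matrix.trace_one, Matrix.trace_mul_comm,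
    ← ofReal_frobSq, smul_eq_mul, sub_nonneg] at h1
  have h2 : ((frobSq h : ℝ) : ℂ) ≤ ((opNorm h ^ 2 * Fintype.card n : ℝ) : ℂ) := by
    exact_mod_cast h1
  rw [mul_comm]
  exact Complex.real_le_real.1 h2

lemma re_dotProduct_piKron_diag_le [DecidableEq ι] (j : ι) (h V : Matrix n n ℂ)
    (hV : V ∈ Matrix.unitaryGroup n ℂ) (φ : (ι → n) → ℂ) (hφ : ∑ x, ‖φ x‖ ^ 2 = 1) :
    (star φ ⬝ᵥ piKron (Pi.mulSingle j (star V * (star h * h) * V)) *ᵥ φ).re ≤ opNorm h ^ 2 := by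
  obtain ⟨B, hB⟩ : ∃ B : Matrix n n ℂ,
      ((opNorm h ^ 2 : ℝ) : ℂ) • (1 : Matrix n n ℂ) - star h * h = star B * B := by
    open scoped MatrixOrder in
    exact CStarAlgebra.nonneg_iff_eq_star_mul_self.1 (posSemidef_opNorm_sub h).nonneg
  have hV' := Matrix.mem_unitaryGroup_iff'.1 hV
  have h1 : star V * (star h * h) * V
      = ((opNorm h ^ 2 : ℝ) : ℂ) • (1 : Matrix n n ℂ) - star (B * V) * (B * V) := by
    have : star (B * V) * (B * V) = star V * (star B * B) * V := by
      simp only [star_mul, Matrix.mul_assoc]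
    rw [this, ← hB, Matrix.mul_sub, Matrix.sub_mul, Matrix.mul_smul, Matrix.mul_one,
      Matrix.smul_mul, hV', sub_sub_cancel]
  have h2 : piKron (Pi.mulSingle j (star V * (star h * h) * V))
      = ((opNorm h ^ 2 : ℝ) : ℂ) • (1 : Matrix (ι → n) (ι → n) ℂ)
        - star (piKron (Pi.mulSingle j (B * V))) * piKron (Pi.mulSingle j (B * V)) := by
    rw [star_piKron, piKron_mul, star_mulSingle, ← Pi.mulSingle_mul, h1, ← piKron_one,
      ← Pi.mulSingle_one j]
    ext x y
    rw [Matrix.sub_apply, Matrix.smul_apply]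
    simp only [piKron_mulSingle_apply]
    split_ifs <;> simp
  have h3 (C : Matrix (ι → n) (ι → n) ℂ) :
      star φ ⬝ᵥ ((star C * C) *ᵥ φ) = ((∑ i, ‖(C *ᵥ φ) i‖ ^ 2 : ℝ) : ℂ) := by
    rw [← star_dotProduct_self, ← Matrix.mulVec_mulVec, Matrix.dotProduct_mulVec,
      Matrix.star_mulVec, Matrix.star_eq_conjTranspose]
  rw [h2, Matrix.sub_mulVec, dotProduct_sub, h3, Matrix.smul_mulVec, Matrix.one_mulVec,
    dotProduct_smul, star_dotProduct_self, hφ, smul_eq_mul, ← Complex.ofReal_mul,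
    ← Complex.ofReal_sub, Complex.ofReal_re]
  have : 0 ≤ ∑ i, ‖(piKron (Pi.mulSingle j (B * V)) *ᵥ φ) i‖ ^ 2 := by positivity
  linarith

end ProductOperators

section Purity

variable {X A B : Type*} [Fintype X] [Fintype A] [Fintype B]

/-- The unnormalised reduced density matrix on `A` of a vector on `X ≃ A × B`. -/
def reducedMatrix (e : A × B ≃ X) (φ : X → ℂ) : Matrix A A ℂ :=
  Matrix.of fun a a' => ∑ b, φ (e (a, b)) * star (φ (e (a', b)))

/-- The purity of the reduced density matrix. -/
def purity (e : A × B ≃ X) (φ : X → ℂ) : ℝ := frobSq (reducedMatrix e φ)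

lemma trace_reducedMatrix (e : A × B ≃ X) (φ : X → ℂ) :
    (reducedMatrix e φ).trace = ((∑ x, ‖φ x‖ ^ 2 : ℝ) : ℂ) := by
  rw [← Equiv.sum_comp e, Fintype.sum_prod_type]
  simp [Matrix.trace, reducedMatrix, Complex.mul_conj']

lemma frobSq_sub_smul_one [DecidableEq A] [Nonempty A] (M : Matrix A A ℂ) (hM : M.trace = 1) :
    frobSq (M - ((Fintype.card A : ℂ)⁻¹) • 1) = frobSq M - (Fintype.card A : ℝ)⁻¹ := by
  have hA : (Fintype.card A : ℂ) ≠ 0 := by simp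
  have hM' : (star M).trace = 1 := by
    rw [Matrix.star_eq_conjTranspose, Matrix.trace_conjTranspose, hM, star_one]
  have : ((frobSq (M - ((Fintype.card A : ℂ)⁻¹) • 1) : ℝ) : ℂ)
      = ((frobSq M - (Fintype.card A : ℝ)⁻¹ : ℝ) : ℂ) := by
    push_cast
    rw [ofReal_frobSq, ofReal_frobSq, star_sub, star_smul, star_one, star_inv₀, star_natCast,
      Matrix.sub_mul, Matrix.mul_sub, Matrix.mul_sub]
    simp only [Matrix.mul_smul, Matrix.smul_mul, Matrix.mul_one, Matrix.one_mul,
      Matrix.trace_sub, Matrix.trace_smul, Matrix.trace_one, hM, hM', smul_eq_mul]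
    field_simp
    ring
  exact_mod_cast this

lemma norm_trace_mul_sq_le (O M : Matrix A A ℂ) :
    ‖(O * M).trace‖ ^ 2 ≤ frobSq O * frobSq M := by
  have h1 : ‖(O * M).trace‖ ≤ ∑ p : A × A, ‖O p.1 p.2‖ * ‖M p.2 p.1‖ := by
    rw [Fintype.sum_prod_type]
    simp only [Matrix.trace, Matrix.diag, Matrix.mul_apply]
    refine (norm_sum_le _ _).trans (Finset.sum_le_sum fun a _ => (norm_sum_le _ _).trans ?_)
    exact Finset.sum_le_sum fun b _ => (norm_mul_le _ _)
  refine (pow_le_pow_left₀ (norm_nonneg _) h1 2).trans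
    ((Finset.sum_mul_sq_le_sq_mul_sq _ _ _).trans (le_of_eq ?_))
  congr 1
  · rw [Fintype.sum_prod_type, frobSq]
  · rw [Fintype.sum_prod_type, Finset.sum_comm, frobSq]

lemma inv_card_le_purity [DecidableEq A] [Nonempty A] (e : A × B ≃ X) (φ : X → ℂ) (hφ : ∑ x, ‖φ x‖ ^ 2 = 1) :
    (Fintype.card A : ℝ)⁻¹ ≤ purity e φ := by
  have h := frobSq_sub_smul_one (reducedMatrix e φ) (by rw [trace_reducedMatrix, hφ]; simp)
  have h0 := frobSq_nonneg (reducedMatrix e φ - ((Fintype.card A : ℂ)⁻¹) • 1)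
  rw [purity]
  linarith

lemma dotProduct_mulVec_eq_trace [DecidableEq B] (e : A × B ≃ X) (φ : X → ℂ) (K : Matrix X X ℂ)
    (O : Matrix A A ℂ)
    (hK : ∀ a b a' b', K (e (a, b)) (e (a', b')) = if b = b' then O a a' else 0) :
    star φ ⬝ᵥ K *ᵥ φ = (O * reducedMatrix e φ).trace := by
  simp only [dotProduct, Matrix.mulVec, Matrix.trace, Matrix.diag, Matrix.mul_apply,
    reducedMatrix, Matrix.of_apply]
  rw [← Equiv.sum_comp e, Fintype.sum_prod_type]
  refine Finset.sum_congr rfl fun a _ => ?_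
  simp only [← Equiv.sum_comp e (fun x => K _ x * φ x), Fintype.sum_prod_type, hK, ite_mul,
    zero_mul, Finset.sum_ite_eq, Finset.mem_univ, if_true, Finset.mul_sum]
  rw [Finset.sum_comm]
  refine Finset.sum_congr rfl fun a' _ => Finset.sum_congr rfl fun b _ => ?_
  simp only [Pi.star_apply]
  ring

lemma norm_dotProduct_mulVec_sq_le [DecidableEq A] [DecidableEq B] [Nonempty A] (e : A × B ≃ X) (φ : X → ℂ)
    (hφ : ∑ x, ‖φ x‖ ^ 2 = 1) (K : Matrix X X ℂ) (O : Matrix A A ℂ) (hO : O.trace = 0)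
    (hK : ∀ a b a' b', K (e (a, b)) (e (a', b')) = if b = b' then O a a' else 0) :
    ‖star φ ⬝ᵥ K *ᵥ φ‖ ^ 2 ≤ frobSq O * (purity e φ - (Fintype.card A : ℝ)⁻¹) := by
  rw [dotProduct_mulVec_eq_trace e φ K O hK, purity, ← frobSq_sub_smul_one (reducedMatrix e φ)
    (by rw [trace_reducedMatrix, hφ]; simp)]
  refine le_trans (le_of_eq ?_) (norm_trace_mul_sq_le _ _)
  rw [Matrix.mul_sub, Matrix.trace_sub, Matrix.mul_smul, Matrix.mul_one, Matrix.trace_smul, hO,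
    smul_zero, sub_zero]

end Purity

section PairOperators

variable {ι n : Type*} [Fintype ι] [DecidableEq ι] [DecidableEq n]

/-- The configurations on `ι`, split into those on the sites `j`, `k` and those on the rest. -/
def pairSplit (n : Type*) (j k : ι) :
    ({i // i = j ∨ i = k} → n) × ({i // ¬(i = j ∨ i = k)} → n) ≃ (ι → n) :=
  (Equiv.piEquivPiSubtypeProd (fun i => i = j ∨ i = k) fun _ => n).symm

lemma card_pair {j k : ι} (hjk : j ≠ k) : Fintype.card {i // i = j ∨ i = k} = 2 := by
  rw [Fintype.card_subtype, ← Finset.card_pair hjk]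
  congr 1
  ext i
  simp

lemma prod_pair {M : Type*} [CommMonoid M] {j k : ι} (hjk : j ≠ k) (f : ι → M) :
    ∏ i : {i // i = j ∨ i = k}, f i = f j * f k := by
  rw [← Finset.prod_pair hjk]
  exact (Finset.prod_subtype _ (by simp) f).symm

lemma piKron_pairSplit (j k : ι) (A : ι → Matrix n n ℂ) (hA : ∀ i, i ≠ j → i ≠ k → A i = 1)
    (a b a' b') :
    piKron A (pairSplit n j k (a, b)) (pairSplit n j k (a', b'))
      = if b = b' then piKron (fun i : {i // i = j ∨ i = k} => A i) a a' else 0 := by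
  rw [piKron_apply, ← Fintype.prod_subtype_mul_prod_subtype (fun i => i = j ∨ i = k)]
  have h1 : ∏ i : {i // ¬(i = j ∨ i = k)},
      A i (pairSplit n j k (a, b) i) (pairSplit n j k (a', b') i) = if b = b' then 1 else 0 := by
    rw [← Matrix.one_apply, ← piKron_one, piKron_apply]
    refine Finset.prod_congr rfl fun i _ => ?_
    rw [hA i (fun hi => i.2 (.inl hi)) (fun hi => i.2 (.inr hi)), Pi.one_apply]
    exact congr_arg₂ _ (dif_neg i.2) (dif_neg i.2)
  have h2 : ∏ i : {i // i = j ∨ i = k},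
      A i (pairSplit n j k (a, b) i) (pairSplit n j k (a', b') i)
      = piKron (fun i : {i // i = j ∨ i = k} => A i) a a' := by
    rw [piKron_apply]
    refine Finset.prod_congr rfl fun i _ => ?_
    exact congr_arg₂ _ (dif_pos i.2) (dif_pos i.2)
  rw [h1, h2, mul_ite, mul_one, mul_zero]

variable [Fintype n]

lemma norm_dotProduct_piKron_sq_le [Nonempty n] {j k : ι} (hjk : j ≠ k) (A : ι → Matrix n n ℂ)
    (hA : ∀ i, i ≠ j → i ≠ k → A i = 1) (hj : (A j).trace = 0) (φ : (ι → n) → ℂ)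
    (hφ : ∑ x, ‖φ x‖ ^ 2 = 1) :
    ‖star φ ⬝ᵥ piKron A *ᵥ φ‖ ^ 2 ≤ frobSq (A j) * frobSq (A k)
      * (purity (pairSplit n j k) φ - ((Fintype.card n : ℝ) ^ 2)⁻¹) := by
  have h := norm_dotProduct_mulVec_sq_le (pairSplit n j k) φ hφ (piKron A)
    (piKron fun i : {i // i = j ∨ i = k} => A i)
    (by rw [trace_piKron, prod_pair hjk fun i => (A i).trace, hj, zero_mul])
    (piKron_pairSplit j k A hA)
  rw [frobSq_piKron, prod_pair hjk fun i => frobSq (A i)] at h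
  rwa [Fintype.card_fun, card_pair hjk, Nat.cast_pow] at h

/-- A bound on the pair contribution to the variance, linear in the purity. -/
lemma norm_dotProduct_piKron_pair_le [Nonempty n] {j k : ι} (hjk : j ≠ k) (h : Matrix n n ℂ)
    (htr : h.trace = 0) (V : ι → Matrix n n ℂ) (hV : ∀ i, V i ∈ Matrix.unitaryGroup n ℂ)
    (φ : (ι → n) → ℂ) (hφ : ∑ x, ‖φ x‖ ^ 2 = 1) {ε : ℝ} (hε : 0 < ε) :
    ‖star φ ⬝ᵥ piKron (star V * (Pi.mulSingle j h * Pi.mulSingle k h) * V) *ᵥ φ‖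
      ≤ Fintype.card n * opNorm h ^ 2
        * (((purity (pairSplit n j k) φ - ((Fintype.card n : ℝ) ^ 2)⁻¹) / ε + ε) / 2) := by
  have hV' (i) := Matrix.mem_unitaryGroup_iff'.1 (hV i)
  have hVj (i) := Matrix.mem_unitaryGroup_iff.1 (hV i)
  have e1 : (star V * (Pi.mulSingle j h * Pi.mulSingle k h) * V : ι → Matrix n n ℂ) j
      = star (V j) * h * V j := by
    simp [Pi.mulSingle_eq_of_ne hjk]
  have e2 : (star V * (Pi.mulSingle j h * Pi.mulSingle k h) * V : ι → Matrix n n ℂ) k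
      = star (V k) * h * V k := by
    simp [Pi.mulSingle_eq_of_ne hjk.symm]
  have key := norm_dotProduct_piKron_sq_le hjk
    (star V * (Pi.mulSingle j h * Pi.mulSingle k h) * V)
    (fun i hij hik => by
      simp [Pi.mulSingle_eq_of_ne hij, Pi.mulSingle_eq_of_ne hik, hV'])
    (by rw [e1, Matrix.trace_mul_comm, ← Matrix.mul_assoc, hVj, Matrix.one_mul, htr]) φ hφ
  rw [e1, e2, frobSq_conj _ (hV j), frobSq_conj _ (hV k)] at key
  set t := purity (pairSplit n j k) φ - ((Fintype.card n : ℝ) ^ 2)⁻¹ with ht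
  have ht0 : 0 ≤ t := by
    have := inv_card_le_purity (pairSplit n j k) φ hφ
    rw [Fintype.card_fun, card_pair hjk, Nat.cast_pow] at this
    linarith
  have hs : √t ≤ (t / ε + ε) / 2 := by
    have h1 : t / ε = √t ^ 2 / ε := by rw [Real.sq_sqrt ht0]
    rw [h1, le_div_iff₀ two_pos, div_add' _ _ _ hε.ne', le_div_iff₀ hε]
    nlinarith [sq_nonneg (√t - ε)]
  refine le_trans ?_ (mul_le_mul (frobSq_le h) hs (Real.sqrt_nonneg _) (by positivity))
  refine abs_le_of_sq_le_sq' ?_ (mul_nonneg (frobSq_nonneg h) (Real.sqrt_nonneg _)) |>.2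
  rw [mul_pow, Real.sq_sqrt ht0, sq (frobSq h)]
  exact key

end PairOperators

section HaarState

lemma sum_add_div_four_mul_delta {A B : Type*} [Fintype A] [Fintype B]
    [DecidableEq A] [DecidableEq B] (α : A → B → ℝ) :
    ∑ a, ∑ a', ∑ b, ∑ b', (α a b + α a' b') / 4
        * ((if a = a' then 1 else 0) + if b = b' then 1 else 0)
      = (∑ a, ∑ b, α a b) * ((Fintype.card A + Fintype.card B) / 2) := by
  have hδ (a : A) (b : B) : ∑ a', ∑ b', ((if a = a' then 1 else 0) + if b = b' then 1 else 0)
      = (Fintype.card A + Fintype.card B : ℝ) := by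
    simp [Finset.sum_add_distrib, add_comm]
  have h1 : ∑ a, ∑ a', ∑ b, ∑ b', α a b
        * ((if a = a' then 1 else 0) + if b = b' then 1 else 0)
      = (∑ a, ∑ b, α a b) * (Fintype.card A + Fintype.card B) := by
    rw [Finset.sum_mul]
    refine Finset.sum_congr rfl fun a _ => ?_
    rw [Finset.sum_comm, Finset.sum_mul]
    refine Finset.sum_congr rfl fun b _ => ?_
    simp only [← Finset.mul_sum, hδ]
  have h2 : ∑ a, ∑ a', ∑ b, ∑ b', α a' b'
        * ((if a = a' then 1 else 0) + if b = b' then 1 else 0)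
      = (∑ a, ∑ b, α a b) * (Fintype.card A + Fintype.card B) := by
    rw [← h1, Finset.sum_comm]
    refine Finset.sum_congr rfl fun a _ => Finset.sum_congr rfl fun a' _ => ?_
    rw [Finset.sum_comm]
    simp only [eq_comm]
  simp only [add_div, add_mul, div_mul_eq_mul_div, Finset.sum_add_distrib, ← Finset.sum_div,
    h1, h2]
  ring

lemma continuous_purity {X A B : Type*} [Fintype A] [Fintype B] (e : A × B ≃ X) : Continuous (purity e) := by
  unfold purity frobSq reducedMatrix
  simp only [Matrix.of_apply]
  fun_prop

variable {X : Type*} [Fintype X]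

lemma isCompact_sum_norm_sq_eq_one : IsCompact {φ : X → ℂ | ∑ x, ‖φ x‖ ^ 2 = 1} := by
  refine Metric.isCompact_of_isClosed_isBounded
    (isClosed_eq (by fun_prop) continuous_const) ?_
  refine (Metric.isBounded_closedBall (x := (0 : X → ℂ)) (r := 1)).subset fun φ hφ => ?_
  rw [mem_closedBall_zero_iff, pi_norm_le_iff_of_nonneg zero_le_one]
  intro x
  have : ‖φ x‖ ^ 2 ≤ 1 := by
    rw [← (show ∑ x, ‖φ x‖ ^ 2 = 1 from hφ)]
    exact Finset.single_le_sum (f := fun x => ‖φ x‖ ^ 2) (fun _ _ => by positivity)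
      (Finset.mem_univ x)
  exact (sq_le_one_iff₀ (norm_nonneg _)).1 this

variable [DecidableEq X]

/-- A law of random pure states that is invariant under the special unitary group. -/
structure IsHaarState (ν : Measure (X → ℂ)) : Prop where
  map_mulVec : ∀ g ∈ Matrix.specialUnitaryGroup X ℂ, ν.map (fun φ => g *ᵥ φ) = ν
  ae_norm : ∀ᵐ φ ∂ν, ∑ x, ‖φ x‖ ^ 2 = 1

/-- The phase gate multiplying the coordinate `x` by `ω`. -/
def phaseGate (x : X) (ω : ℂ) : Matrix X X ℂ := Matrix.diagonal (Pi.mulSingle x ω)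

lemma phaseGate_mem (x : X) {ω : ℂ} (hω : ‖ω‖ = 1) :
    phaseGate x ω ∈ Matrix.unitaryGroup X ℂ := by
  rw [Matrix.mem_unitaryGroup_iff, phaseGate, Matrix.star_eq_conjTranspose,
    Matrix.diagonal_conjTranspose, Matrix.diagonal_mul_diagonal, ← Matrix.diagonal_one]
  congr 1
  ext1 i
  by_cases hi : i = x
  · subst hi; simp [Complex.mul_conj', hω]
  · simp [Pi.mulSingle_eq_of_ne hi]

lemma phaseGate_mulVec_same (x : X) (ω : ℂ) (φ : X → ℂ) : (phaseGate x ω *ᵥ φ) x = ω * φ x := by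
  simp [phaseGate, Matrix.mulVec_diagonal]

lemma phaseGate_mulVec_of_ne {x y : X} (hy : y ≠ x) (ω : ℂ) (φ : X → ℂ) :
    (phaseGate x ω *ᵥ φ) y = φ y := by
  simp [phaseGate, Matrix.mulVec_diagonal, Pi.mulSingle_eq_of_ne hy]

/-- A unitary mixing the coordinates `x` and `y` as a balanced beam splitter. -/
def beamSplitter (x y : X) : Matrix X X ℂ :=
  1 + ((Complex.I - 1) / 2) • Matrix.vecMulVec (Pi.single x 1 + Pi.single y 1)
    (Pi.single x 1 + Pi.single y 1)

lemma beamSplitter_mem {x y : X} (hxy : x ≠ y) :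
    beamSplitter x y ∈ Matrix.unitaryGroup X ℂ := by
  set v : X → ℂ := Pi.single x 1 + Pi.single y 1 with hv
  have hvv : v ⬝ᵥ v = 2 := by
    simp [hv, hxy, hxy.symm]; norm_num
  have hsv : star v = v := by
    simp [hv]
  have hP : Matrix.vecMulVec v v * Matrix.vecMulVec v v = (2 : ℂ) • Matrix.vecMulVec v v := by
    rw [Matrix.vecMulVec_mul_vecMulVec, hvv]
    ext i j; simp [Matrix.vecMulVec_apply]; ring
  have hsP : star (Matrix.vecMulVec v v) = Matrix.vecMulVec v v := by
    rw [Matrix.star_eq_conjTranspose, Matrix.conjTranspose_vecMulVec, hsv]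
  rw [Matrix.mem_unitaryGroup_iff, beamSplitter, ← hv, star_add, star_smul, hsP, star_one,
    Matrix.add_mul, Matrix.mul_add, Matrix.mul_add, Matrix.smul_mul, Matrix.smul_mul,
    Matrix.mul_smul, Matrix.mul_smul, hP, Matrix.one_mul, Matrix.mul_one, Matrix.one_mul, add_assoc, add_eq_left,
    smul_smul, smul_smul, ← add_smul, ← add_smul]
  convert zero_smul ℂ _
  simp only [star_div₀, star_sub, star_one, star_ofNat, Complex.star_def, Complex.conj_I]
  ring_nf
  simp

lemma beamSplitter_mulVec_left {x y : X} (hxy : x ≠ y) (φ : X → ℂ) :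
    (beamSplitter x y *ᵥ φ) x = (1 + Complex.I) / 2 * (φ x + Complex.I * φ y) := by
  rw [beamSplitter, Matrix.add_mulVec, Matrix.one_mulVec, Matrix.smul_mulVec,
    Matrix.vecMulVec_mulVec]
  simp [hxy]
  ring_nf
  simp; ring

lemma beamSplitter_mulVec_right {x y : X} (hxy : x ≠ y) (φ : X → ℂ) :
    (beamSplitter x y *ᵥ φ) y = (1 + Complex.I) / 2 * (φ y + Complex.I * φ x) := by
  rw [beamSplitter, Matrix.add_mulVec, Matrix.one_mulVec, Matrix.smul_mulVec,
    Matrix.vecMulVec_mulVec]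
  simp [hxy.symm]
  ring_nf
  simp; ring

lemma sum_norm_pow_four_beamSplitter {x y : X} (hxy : x ≠ y) (φ : X → ℂ) :
    (‖(beamSplitter x y *ᵥ φ) x‖ ^ 4 + ‖(beamSplitter x y *ᵥ φ) y‖ ^ 4)
      + (‖(beamSplitter x y *ᵥ (phaseGate y Complex.I *ᵥ φ)) x‖ ^ 4
        + ‖(beamSplitter x y *ᵥ (phaseGate y Complex.I *ᵥ φ)) y‖ ^ 4)
      = (‖φ x‖ ^ 4 + ‖φ y‖ ^ 4) + 4 * (‖φ x‖ ^ 2 * ‖φ y‖ ^ 2) := by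
  have h4 (z : ℂ) : ‖z‖ ^ 4 = (z.re * z.re + z.im * z.im) ^ 2 := by
    rw [← Complex.normSq_apply, Complex.normSq_eq_norm_sq]; ring
  have h2 (z : ℂ) : ‖z‖ ^ 2 = z.re * z.re + z.im * z.im := by
    rw [← Complex.normSq_apply, Complex.normSq_eq_norm_sq]
  simp only [beamSplitter_mulVec_left hxy, beamSplitter_mulVec_right hxy,
    phaseGate_mulVec_same, phaseGate_mulVec_of_ne hxy, h4, h2]
  simp
  ring

namespace IsHaarState

variable {ν : Measure (X → ℂ)}

lemma integral_comp_mulVec [Nonempty X] (hν : IsHaarState ν) {f : (X → ℂ) → ℝ}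
    (hf : Continuous f) (hphase : ∀ c : ℂ, ‖c‖ = 1 → ∀ φ, f (c • φ) = f φ)
    {g : Matrix X X ℂ} (hg : g ∈ Matrix.unitaryGroup X ℂ) :
    ∫ φ, f (g *ᵥ φ) ∂ν = ∫ φ, f φ ∂ν := by
  have hdet : star g.det * g.det = 1 :=
    (Unitary.mem_iff.1 (Matrix.det_of_mem_unitary hg)).1
  have hdetn : ‖g.det‖ = 1 := by
    have := congr_arg norm hdet
    rw [norm_mul, norm_star, norm_one, ← sq] at this
    exact (pow_eq_one_iff_of_nonneg (norm_nonneg _) two_ne_zero).1 this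
  obtain ⟨c, hc⟩ := IsAlgClosed.exists_pow_nat_eq (star g.det) (Fintype.card_pos (α := X))
  have hcn : ‖c‖ = 1 := by
    have := congr_arg norm hc
    rw [norm_pow, norm_star, hdetn] at this
    exact (pow_eq_one_iff_of_nonneg (norm_nonneg _) Fintype.card_ne_zero).1 this
  have hcg : c • g ∈ Matrix.specialUnitaryGroup X ℂ := by
    refine Matrix.mem_specialUnitaryGroup_iff.2 ⟨?_, ?_⟩
    · rw [Matrix.mem_unitaryGroup_iff, star_smul, Matrix.smul_mul, Matrix.mul_smul,
        Matrix.mem_unitaryGroup_iff.1 hg, smul_smul, Complex.star_def, Complex.mul_conj', hcn]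
      simp
    · rw [Matrix.det_smul, hc, hdet]
  have hmeas : Continuous fun φ : X → ℂ => (c • g) *ᵥ φ := by fun_prop
  calc ∫ φ, f (g *ᵥ φ) ∂ν = ∫ φ, f ((c • g) *ᵥ φ) ∂ν := by
        simp only [Matrix.smul_mulVec, hphase c hcn]
    _ = ∫ φ, f φ ∂(ν.map fun φ => (c • g) *ᵥ φ) :=
        (integral_map hmeas.measurable.aemeasurable hf.aestronglyMeasurable).symm
    _ = _ := by rw [hν.map_mulVec _ hcg]

lemma integral_eq_zero (hν : IsHaarState ν) {x y z w : X} (hy : y ≠ x) (hz : z ≠ x)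
    (hw : w ≠ x) :
    ∫ φ, (φ x * star (φ y) * star (φ z * star (φ w))).re ∂ν = 0 := by
  have : Nonempty X := ⟨x⟩
  have h := hν.integral_comp_mulVec
    (f := fun φ => (φ x * star (φ y) * star (φ z * star (φ w))).re) (by fun_prop)
    (fun c hc φ => by
      have : c * star c = 1 := by rw [Complex.star_def, Complex.mul_conj', hc]; simp
      congr 1
      simp only [Pi.smul_apply, smul_eq_mul, star_mul, star_star]
      linear_combination (φ x * star (φ y) * star (φ z) * φ w) * (c * star c + 1) * this)
    (phaseGate_mem x (ω := -1) (by simp))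
  simp only [phaseGate_mulVec_same, phaseGate_mulVec_of_ne hy, phaseGate_mulVec_of_ne hz,
    phaseGate_mulVec_of_ne hw, neg_mul, one_mul, Complex.neg_re, integral_neg] at h
  linarith

variable [IsProbabilityMeasure ν]

lemma integrable (hν : IsHaarState ν) {f : (X → ℂ) → ℝ} (hf : Continuous f) :
    Integrable f ν := by
  obtain ⟨C, hC⟩ := isCompact_sum_norm_sq_eq_one.exists_bound_of_continuousOn (hf.continuousOn)
  refine Integrable.of_bound hf.aestronglyMeasurable C ?_
  filter_upwards [hν.ae_norm] with φ hφ using hC φ hφ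

lemma integral_norm_pow_four_add (hν : IsHaarState ν) {x y : X} (hxy : x ≠ y) :
    ∫ φ, ‖φ x‖ ^ 4 ∂ν + ∫ φ, ‖φ y‖ ^ 4 ∂ν = 4 * ∫ φ, ‖φ x‖ ^ 2 * ‖φ y‖ ^ 2 ∂ν := by
  have : Nonempty X := ⟨x⟩
  have hf : Continuous fun φ : X → ℂ => ‖φ x‖ ^ 4 + ‖φ y‖ ^ 4 := by fun_prop
  have hphase : ∀ c : ℂ, ‖c‖ = 1 → ∀ φ : X → ℂ,
      ‖(c • φ) x‖ ^ 4 + ‖(c • φ) y‖ ^ 4 = ‖φ x‖ ^ 4 + ‖φ y‖ ^ 4 := by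
    intro c hc φ; simp [hc]
  have h1 := hν.integral_comp_mulVec hf hphase (beamSplitter_mem hxy)
  have h2 := hν.integral_comp_mulVec hf hphase
    (mul_mem (beamSplitter_mem hxy) (phaseGate_mem y (ω := Complex.I) (by simp)))
  have h3 := integral_congr_ae (μ := ν)
    (Filter.Eventually.of_forall (sum_norm_pow_four_beamSplitter hxy))
  simp only [← Matrix.mulVec_mulVec] at h2
  rw [integral_add (hν.integrable (by fun_prop)) (hν.integrable (by fun_prop)), h1, h2,
    integral_add (hν.integrable (by fun_prop)) (hν.integrable (by fun_prop)),
    integral_add (f := fun φ : X → ℂ => ‖φ x‖ ^ 4 + ‖φ y‖ ^ 4)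
      (hν.integrable (by fun_prop)) (hν.integrable (by fun_prop)),
    integral_const_mul,
    integral_add (hν.integrable (by fun_prop)) (hν.integrable (by fun_prop))] at h3
  linarith

lemma integral_norm_sq_mul_norm_sq (hν : IsHaarState ν) (x y : X) :
    ∫ φ, ‖φ x‖ ^ 2 * ‖φ y‖ ^ 2 ∂ν
      = (∫ φ, ‖φ x‖ ^ 4 ∂ν + ∫ φ, ‖φ y‖ ^ 4 ∂ν) / 4 * (1 + if x = y then 1 else 0) := by
  by_cases hxy : x = y
  · subst hxy
    have : ∀ φ : X → ℂ, ‖φ x‖ ^ 2 * ‖φ x‖ ^ 2 = ‖φ x‖ ^ 4 := fun φ => by ring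
    simp only [this, if_true]
    ring
  · rw [hν.integral_norm_pow_four_add hxy, if_neg hxy]
    ring

lemma sum_integral_norm_pow_four (hν : IsHaarState ν) :
    (∑ x, ∫ φ, ‖φ x‖ ^ 4 ∂ν) * (Fintype.card X + 1) = 2 := by
  have h1 : ∫ φ, (∑ x, ‖φ x‖ ^ 2) * ∑ y, ‖φ y‖ ^ 2 ∂ν = 1 := by
    rw [integral_congr_ae (g := fun _ => (1 : ℝ))]
    · simp
    · filter_upwards [hν.ae_norm] with φ hφ
      rw [hφ, one_mul]
  simp only [Finset.sum_mul_sum] at h1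
  rw [integral_finsetSum _ fun x _ => hν.integrable (by fun_prop)] at h1
  have h2 (x : X) : ∫ φ, ∑ y, ‖φ x‖ ^ 2 * ‖φ y‖ ^ 2 ∂ν
      = ∑ y, ∫ φ, ‖φ x‖ ^ 2 * ‖φ y‖ ^ 2 ∂ν :=
    integral_finsetSum _ fun y _ => hν.integrable (by fun_prop)
  simp only [h2, hν.integral_norm_sq_mul_norm_sq] at h1
  simp only [mul_add, mul_one, mul_ite, mul_zero,
    Finset.sum_add_distrib, Finset.sum_ite_eq, Finset.mem_univ, if_true, ← Finset.sum_div,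
    Finset.sum_const, Finset.card_univ, nsmul_eq_mul, ← Finset.mul_sum] at h1
  linarith

variable {A B : Type*} [DecidableEq A] [DecidableEq B]

lemma integral_purity_term (hν : IsHaarState ν) (e : A × B ≃ X) (a a' : A) (b b' : B) :
    ∫ φ, (φ (e (a, b)) * star (φ (e (a', b)))
        * star (φ (e (a, b')) * star (φ (e (a', b'))))).re ∂ν
      = (∫ φ, ‖φ (e (a, b))‖ ^ 4 ∂ν + ∫ φ, ‖φ (e (a', b'))‖ ^ 4 ∂ν) / 4
        * ((if a = a' then 1 else 0) + if b = b' then 1 else 0) := by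
  by_cases ha : a = a'
  · subst ha
    have h := hν.integral_norm_sq_mul_norm_sq (e (a, b)) (e (a, b'))
    simp only [e.injective.eq_iff, Prod.mk.injEq, true_and] at h
    rw [if_pos rfl, ← h]
    refine integral_congr_ae (Filter.Eventually.of_forall fun φ => ?_)
    simp only [Complex.star_def, Complex.mul_conj', map_pow, Complex.conj_ofReal]
    norm_cast
  by_cases hb : b = b'
  · subst hb
    have h := hν.integral_norm_sq_mul_norm_sq (e (a, b)) (e (a', b))
    simp only [e.injective.eq_iff, Prod.mk.injEq, and_true, if_neg ha] at h
    rw [if_neg ha, if_pos rfl, zero_add, ← add_zero (1 : ℝ), ← h]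
    refine integral_congr_ae (Filter.Eventually.of_forall fun φ => ?_)
    have : φ (e (a, b)) * star (φ (e (a', b))) * star (φ (e (a, b)) * star (φ (e (a', b))))
        = ((‖φ (e (a, b))‖ ^ 2 * ‖φ (e (a', b))‖ ^ 2 : ℝ) : ℂ) := by
      rw [Complex.star_def, Complex.mul_conj', norm_mul, Complex.norm_conj]
      push_cast; ring
    simp only [this, Complex.ofReal_re]
  · rw [if_neg ha, if_neg hb, add_zero, mul_zero]
    exact hν.integral_eq_zero (by simp [Ne.symm ha]) (by simp [Ne.symm hb]) (by simp [Ne.symm ha])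

variable [Fintype A] [Fintype B]

lemma integral_purity (hν : IsHaarState ν) (e : A × B ≃ X) :
    (∫ φ, purity e φ ∂ν) * (Fintype.card X + 1) = Fintype.card A + Fintype.card B := by
  have h1 (φ : X → ℂ) : purity e φ = ∑ a, ∑ a', ∑ b, ∑ b',
      (φ (e (a, b)) * star (φ (e (a', b))) * star (φ (e (a, b')) * star (φ (e (a', b'))))).re := by
    refine Finset.sum_congr rfl fun a _ => Finset.sum_congr rfl fun a' _ => ?_
    have : ((‖reducedMatrix e φ a a'‖ ^ 2 : ℝ) : ℂ)
        = reducedMatrix e φ a a' * star (reducedMatrix e φ a a') := by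
      rw [Complex.star_def, Complex.mul_conj']; push_cast; rfl
    rw [← Complex.ofReal_re (_ ^ 2), this, reducedMatrix, Matrix.of_apply, star_sum,
      Finset.sum_mul_sum, Complex.re_sum]
    simp only [Complex.re_sum]
  have h2 : ∫ φ, purity e φ ∂ν = ∑ a, ∑ a', ∑ b, ∑ b', ∫ φ, (φ (e (a, b)) * star (φ (e (a', b)))
        * star (φ (e (a, b')) * star (φ (e (a', b'))))).re ∂ν := by
    simp only [h1]
    rw [integral_finsetSum _ fun _ _ => hν.integrable (by fun_prop)]
    refine Finset.sum_congr rfl fun a _ => ?_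
    rw [integral_finsetSum _ fun _ _ => hν.integrable (by fun_prop)]
    refine Finset.sum_congr rfl fun a' _ => ?_
    rw [integral_finsetSum _ fun _ _ => hν.integrable (by fun_prop)]
    refine Finset.sum_congr rfl fun b _ => ?_
    rw [integral_finsetSum _ fun _ _ => hν.integrable (by fun_prop)]
  have hS := hν.sum_integral_norm_pow_four
  rw [← Equiv.sum_comp e, Fintype.sum_prod_type] at hS
  have h3 : ∫ φ, purity e φ ∂ν = (∑ a, ∑ b, ∫ φ, ‖φ (e (a, b))‖ ^ 4 ∂ν)
      * ((Fintype.card A + Fintype.card B) / 2) := by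
    rw [h2]
    simp only [hν.integral_purity_term]
    exact sum_add_div_four_mul_delta fun a b => ∫ φ, ‖φ (e (a, b))‖ ^ 4 ∂ν
  rw [h3]
  linear_combination (Fintype.card A + Fintype.card B : ℝ) / 2 * hS

lemma integral_purity_sub_le [Nonempty A] [Nonempty B] (hν : IsHaarState ν) (e : A × B ≃ X) :
    ∫ φ, (purity e φ - (Fintype.card A : ℝ)⁻¹) ∂ν ≤ Fintype.card A / Fintype.card X := by
  have h := hν.integral_purity e
  have hX : Fintype.card X = Fintype.card A * Fintype.card B := by
    rw [← Fintype.card_congr e, Fintype.card_prod]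
  have hA : (0 : ℝ) < Fintype.card A := by exact_mod_cast Fintype.card_pos
  have hB : (0 : ℝ) < Fintype.card B := by exact_mod_cast Fintype.card_pos
  rw [integral_sub (hν.integrable (continuous_purity e)) (integrable_const _)]
  simp only [integral_const, probReal_univ, one_smul]
  rw [hX, Nat.cast_mul] at h ⊢
  set p := ∫ φ, purity e φ ∂ν
  rw [← eq_div_iff (by positivity)] at h
  rw [h, sub_le_iff_le_add, div_le_iff₀ (by positivity)]
  field_simp
  nlinarith [mul_pos hA hA, mul_pos (mul_pos hA hA) hA, mul_pos hA hB, mul_pos (mul_pos hA hB) hA]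

end IsHaarState

end HaarState

section RandomStates

variable {X : Type*} [Fintype X] [DecidableEq X]

lemma measurable_specialUnitaryGroup_apply (x y : X) :
    Measurable fun U : Matrix.specialUnitaryGroup X ℂ => U.1 x y := by
  have h : Measurable fun M : Matrix X X ℂ => M x y :=
    (measurable_pi_apply y).comp (measurable_pi_apply (X := fun _ : X => X → ℂ) x)
  exact h.comp measurable_subtype_coe

lemma measurable_specialUnitaryGroup_mulVec (ψ : X → ℂ) :
    Measurable fun U : Matrix.specialUnitaryGroup X ℂ => U.1 *ᵥ ψ :=
  measurable_pi_iff.2 fun x => Finset.measurable_fun_sum _ fun y _ =>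
    (measurable_specialUnitaryGroup_apply x y).mul_const _

lemma measurable_specialUnitaryGroup_mul_left (g : Matrix.specialUnitaryGroup X ℂ) :
    Measurable fun U : Matrix.specialUnitaryGroup X ℂ => g * U := by
  refine Measurable.subtype_mk (f := fun U : Matrix.specialUnitaryGroup X ℂ => g.1 * U.1) ?_
  refine measurable_pi_iff.2 fun x => measurable_pi_iff.2 fun y => ?_
  exact Finset.measurable_fun_sum _ fun z _ =>
    (measurable_specialUnitaryGroup_apply z y).const_mul _

lemma sum_norm_sq_mulVec_of_mem_unitaryGroup {U : Matrix X X ℂ}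
    (hU : U ∈ Matrix.unitaryGroup X ℂ) (ψ : X → ℂ) :
    ∑ x, ‖(U *ᵥ ψ) x‖ ^ 2 = ∑ x, ‖ψ x‖ ^ 2 := by
  have h : star (U *ᵥ ψ) ⬝ᵥ (U *ᵥ ψ) = star ψ ⬝ᵥ ψ := by
    rw [Matrix.star_mulVec, ← Matrix.dotProduct_mulVec, Matrix.mulVec_mulVec,
      ← Matrix.star_eq_conjTranspose, Matrix.mem_unitaryGroup_iff'.1 hU, Matrix.one_mulVec]
  rw [star_dotProduct_self, star_dotProduct_self] at h
  exact_mod_cast h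

lemma isHaarState_map (ψ : X → ℂ) (hψ : ∑ x, ‖ψ x‖ ^ 2 = 1)
    (μ : Measure (Matrix.specialUnitaryGroup X ℂ)) [μ.IsMulLeftInvariant] :
    IsHaarState (μ.map fun U => U.1 *ᵥ ψ) where
  map_mulVec g hg := by
    have hc : Measurable fun φ : X → ℂ => g *ᵥ φ := Continuous.measurable (by fun_prop)
    rw [Measure.map_map hc (measurable_specialUnitaryGroup_mulVec ψ)]
    conv_rhs => rw [← map_mul_left_eq_self μ ⟨g, hg⟩]
    rw [Measure.map_map (measurable_specialUnitaryGroup_mulVec ψ)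
      (measurable_specialUnitaryGroup_mul_left _)]
    congr 1
    ext1 U
    simp [Matrix.mulVec_mulVec]
  ae_norm := by
    refine (ae_map_iff (measurable_specialUnitaryGroup_mulVec ψ).aemeasurable
      isCompact_sum_norm_sq_eq_one.isClosed.measurableSet).2 (Filter.Eventually.of_forall ?_)
    intro U
    rw [sum_norm_sq_mulVec_of_mem_unitaryGroup
      (Matrix.specialUnitaryGroup_le_unitaryGroup U.2) ψ, hψ]

end RandomStates

section Variance

variable {d N : ℕ}

lemma localHam_eq_sum_piKron (h : Matrix (Fin d) (Fin d) ℂ) :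
    localHam d N h = ∑ j, piKron (Pi.mulSingle j h) := by
  unfold localHam
  refine Finset.sum_congr rfl fun j _ => ?_
  ext x y
  rw [piKron_mulSingle_apply, Matrix.of_apply]
  congr

lemma trace_conj_localHam_sq (h : Matrix (Fin d) (Fin d) ℂ)
    (V : Fin N → Matrix (Fin d) (Fin d) ℂ)
    (U : Matrix (Fin N → Fin d) (Fin N → Fin d) ℂ) (ψ : (Fin N → Fin d) → ℂ) :
    (tensorProd V * (U * Matrix.vecMulVec ψ (star ψ) * star U) * star (tensorProd V)
        * (localHam d N h * localHam d N h)).trace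
      = ∑ j, ∑ k, star (U *ᵥ ψ)
        ⬝ᵥ piKron (star V * (Pi.mulSingle j h * Pi.mulSingle k h) * V) *ᵥ (U *ᵥ ψ) := by
  have hU : U * Matrix.vecMulVec ψ (star ψ) * star U
      = Matrix.vecMulVec (U *ᵥ ψ) (star (U *ᵥ ψ)) := by
    rw [Matrix.mul_vecMulVec, Matrix.vecMulVec_mul, Matrix.star_mulVec,
      Matrix.star_eq_conjTranspose]
  have hT : tensorProd V = piKron V := rfl
  have hH : star (piKron V) * (localHam d N h * localHam d N h) * piKron V
      = ∑ j, ∑ k, piKron (star V * (Pi.mulSingle j h * Pi.mulSingle k h) * V) := by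
    simp only [localHam_eq_sum_piKron, Finset.mul_sum, Finset.sum_mul, star_piKron, piKron_mul]
    exact Finset.sum_comm
  rw [hU, hT]
  generalize U *ᵥ ψ = φ
  rw [Matrix.mul_assoc, Matrix.mul_assoc, Matrix.trace_mul_comm, Matrix.mul_assoc, hH,
    Matrix.vecMulVec_mul, Matrix.trace_vecMulVec, dotProduct_comm, ← Matrix.dotProduct_mulVec]
  simp only [Matrix.sum_mulVec, dotProduct_sum]

/-- The bound on the `(j, k)` contribution to the second moment of the local Hamiltonian. -/
def pairBound (h : Matrix (Fin d) (Fin d) ℂ) (ε : ℝ) (j k : Fin N)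
    (φ : (Fin N → Fin d) → ℂ) : ℝ :=
  if j = k then opNorm h ^ 2 else
    d * opNorm h ^ 2 * (((purity (pairSplit (Fin d) j k) φ - ((d : ℝ) ^ 2)⁻¹) / ε + ε) / 2)

lemma continuous_pairBound (h : Matrix (Fin d) (Fin d) ℂ) (ε : ℝ) (j k : Fin N) :
    Continuous (pairBound h ε j k) := by
  unfold pairBound
  split_ifs
  · exact continuous_const
  · have := continuous_purity (pairSplit (Fin d) j k)
    fun_prop

lemma FLU_le (hd : 2 ≤ d) (h : Matrix (Fin d) (Fin d) ℂ) (hherm : h.IsHermitian)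
    (htr : h.trace = 0) (ψ : (Fin N → Fin d) → ℂ) (hψ : ∑ x, ‖ψ x‖ ^ 2 = 1)
    (U : Matrix.specialUnitaryGroup (Fin N → Fin d) ℂ) {ε : ℝ} (hε : 0 < ε) :
    FLU d N h ψ U ≤ 4 * ∑ j, ∑ k, pairBound h ε j k (U.1 *ᵥ ψ) := by
  have : Nonempty (Fin d) := ⟨⟨0, by omega⟩⟩
  have hφ : ∑ x, ‖(U.1 *ᵥ ψ) x‖ ^ 2 = 1 := by
    rw [sum_norm_sq_mulVec_of_mem_unitaryGroup
      (Matrix.specialUnitaryGroup_le_unitaryGroup U.2) ψ, hψ]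
  refine ciSup_le fun V => mul_le_mul_of_nonneg_left ((sub_le_self _ (sq_nonneg _)).trans ?_)
    (by norm_num)
  rw [trace_conj_localHam_sq, Complex.re_sum]
  refine Finset.sum_le_sum fun j _ => ?_
  rw [Complex.re_sum]
  refine Finset.sum_le_sum fun k _ => ?_
  rw [pairBound]
  split_ifs with hjk
  · subst hjk
    have hV : (star fun i => (V i : Matrix (Fin d) (Fin d) ℂ))
          * (Pi.mulSingle j h * Pi.mulSingle j h) * (fun i => (V i : Matrix (Fin d) (Fin d) ℂ))
        = Pi.mulSingle j (star (V j : Matrix (Fin d) (Fin d) ℂ) * (star h * h) * (V j).1) := by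
      have hh : star h = h := hherm
      ext1 i
      by_cases hi : i = j
      · subst hi; simp [hh]
      · simp [Pi.mulSingle_eq_of_ne hi, Matrix.mem_unitaryGroup_iff'.1 (V i).2]
    rw [hV]
    exact re_dotProduct_piKron_diag_le j h _ (V j).2 _ hφ
  · have := norm_dotProduct_piKron_pair_le hjk h htr (fun i => (V i).1) (fun i => (V i).2) _ hφ hε
    rw [Fintype.card_fin] at this
    exact (Complex.re_le_norm _).trans this

lemma integral_pairBound_le (hd : 2 ≤ d) (h : Matrix (Fin d) (Fin d) ℂ)
    {ν : Measure ((Fin N → Fin d) → ℂ)} [IsProbabilityMeasure ν] (hν : IsHaarState ν)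
    (j k : Fin N) :
    ∫ φ, pairBound h (d / √(d ^ N)) j k φ ∂ν
      ≤ if j = k then opNorm h ^ 2 else opNorm h ^ 2 * (d ^ 2 / √(d ^ N)) := by
  have : Nonempty (Fin d) := ⟨⟨0, by omega⟩⟩
  have hd0 : (0 : ℝ) < d := by exact_mod_cast (by omega : 0 < d)
  unfold pairBound
  split_ifs with hjk
  · simp
  · have hp := hν.integral_purity_sub_le (pairSplit (Fin d) j k)
    simp only [Fintype.card_fun, card_pair hjk, Fintype.card_fin, Nat.cast_pow] at hp
    have hc := continuous_purity (pairSplit (Fin d) j k)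
    set ε : ℝ := d / √(d ^ N) with hε
    have hs : (0 : ℝ) < √(d ^ N) := by positivity
    have hε0 : 0 < ε := by positivity
    have hε2 : (d : ℝ) ^ 2 / d ^ N = ε ^ 2 := by
      rw [hε, div_pow, Real.sq_sqrt (by positivity)]
    rw [hε2] at hp
    rw [integral_const_mul, integral_div,
      integral_add (hν.integrable (by fun_prop)) (integrable_const _), integral_div]
    simp only [integral_const, probReal_univ, one_smul]
    have h2 : (d : ℝ) ^ 2 / √(d ^ N) = d * ε := by rw [hε]; ring
    rw [h2, ← mul_assoc, mul_comm (opNorm h ^ 2)]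
    refine mul_le_mul_of_nonneg_left ?_ (by positivity)
    have h3 : (∫ φ, (purity (pairSplit (Fin d) j k) φ - ((d : ℝ) ^ 2)⁻¹) ∂ν) / ε ≤ ε := by
      rw [div_le_iff₀ hε0, ← sq]
      exact hp
    linarith

end Variance

/-- upper bound on the Haar expectation of the LU-optimized QFI of random
pure states of `N` distinguishable particles. -/
theorem flu_average_upper_bound (d N : ℕ) (hd : 2 ≤ d) (hN : 1 ≤ N)
    (h : Matrix (Fin d) (Fin d) ℂ) (hherm : h.IsHermitian) (htr : Matrix.trace h = 0)
    (ψ : (Fin N → Fin d) → ℂ) (hψ : ∑ x, ‖ψ x‖ ^ 2 = 1)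
    (μ : Measure (Matrix.specialUnitaryGroup (Fin N → Fin d) ℂ))
    [IsProbabilityMeasure μ] [μ.IsMulLeftInvariant] :
    ∫ U, FLU d N h ψ U ∂μ
      ≤ 4 * N * opNorm h ^ 2 * (1 + (N - 1) * d ^ 2 / Real.sqrt (d ^ N)) := by
  have hd0 : (0 : ℝ) < d := by exact_mod_cast (by omega : 0 < d)
  set ε : ℝ := d / √(d ^ N) with hε
  have hε0 : 0 < ε := by positivity
  have hmeas := measurable_specialUnitaryGroup_mulVec ψ
  have hν := isHaarState_map ψ hψ μ
  have : IsProbabilityMeasure (μ.map fun U => U.1 *ᵥ ψ) :=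
    Measure.isProbabilityMeasure_map hmeas.aemeasurable
  by_cases hint : Integrable (FLU d N h ψ) μ
  swap
  · rw [integral_undef hint]
    have : (0 : ℝ) ≤ N - 1 := by
      rw [sub_nonneg]; exact_mod_cast hN
    positivity
  have hcont : Continuous fun φ => 4 * ∑ j, ∑ k, pairBound (N := N) h ε j k φ := by
    have := continuous_pairBound (N := N) h ε
    fun_prop
  calc ∫ U, FLU d N h ψ U ∂μ
      ≤ ∫ U, 4 * ∑ j, ∑ k, pairBound h ε j k (U.1 *ᵥ ψ) ∂μ :=
        integral_mono hint ((hν.integrable hcont).comp_measurable hmeas)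
          fun U => FLU_le hd h hherm htr ψ hψ U hε0
    _ = ∫ φ, 4 * ∑ j, ∑ k, pairBound h ε j k φ ∂(μ.map fun U => U.1 *ᵥ ψ) :=
        (integral_map hmeas.aemeasurable hcont.aestronglyMeasurable).symm
    _ = 4 * ∑ j, ∑ k, ∫ φ, pairBound h ε j k φ ∂(μ.map fun U => U.1 *ᵥ ψ) := by
        have hi (j k : Fin N) := hν.integrable (continuous_pairBound h ε j k)
        rw [integral_const_mul, integral_finsetSum _ fun j _ =>
          integrable_finsetSum _ fun k _ => hi j k]
        simp only [integral_finsetSum _ fun k _ => hi _ k]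
    _ ≤ 4 * ∑ j : Fin N, ∑ k : Fin N,
        if j = k then opNorm h ^ 2 else opNorm h ^ 2 * (d ^ 2 / √(d ^ N)) := by
        gcongr with j _ k _
        exact integral_pairBound_le hd h hν j k
    _ = 4 * N * opNorm h ^ 2 * (1 + (N - 1) * d ^ 2 / √(d ^ N)) := by
        have hjk (j k : Fin N) :
            (if j = k then opNorm h ^ 2 else opNorm h ^ 2 * (d ^ 2 / √(d ^ N)))
              = opNorm h ^ 2 * (d ^ 2 / √(d ^ N))
                + if j = k then opNorm h ^ 2 * (1 - d ^ 2 / √(d ^ N)) else 0 := by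
          split_ifs <;> ring
        simp only [hjk, Finset.sum_add_distrib, Finset.sum_ite_eq, Finset.mem_univ, if_true,
          Finset.sum_const, Finset.card_univ, Fintype.card_fin, nsmul_eq_mul]
        ring

end Paper
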